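/- Define ℂ-linear functionals on H via its basis {a^i, b·a^i : 0 ≤ i ≤ 2p-1}: ε(a^i) = 1, ε(b·a^i) = 0; g̃(a^i) = ξ^{-i}, g̃(b·a^i) = 0; x̃(a^i) = 0, x̃(b·a^i) = 1. Then g̃(1) = 1 and g̃(h·k) = g̃(h)·g̃(k) for all h, k ∈ H (so g̃ is a ℂ-algebra homomorphism, i.e. a group-like element of the dual), and x̃(h·k) = x̃(h)·ε(k) + g̃(h)·x̃(k) for all h, k ∈ H (so x̃ is an (ε, g̃)-skew-primitive element of the dual). -/

import Mathlib

open scoped TensorProduct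

noncomputable section

/-- The defining relations of the dual Radford algebra `H_{p,-1}`:
`a^(2p) = 1`, `b² = 0`, `b·a = ξ·(a·b)`, where `a` is `ι 0` and `b` is `ι 1`. -/
inductive HRel (p : ℕ) (ξ : ℂ) : FreeAlgebra ℂ (Fin 2) → FreeAlgebra ℂ (Fin 2) → Prop
  | a_pow : HRel p ξ (FreeAlgebra.ι ℂ (0 : Fin 2) ^ (2 * p)) 1
  | b_sq : HRel p ξ (FreeAlgebra.ι ℂ (1 : Fin 2) * FreeAlgebra.ι ℂ (1 : Fin 2)) 0
  | b_a : HRel p ξ (FreeAlgebra.ι ℂ (1 : Fin 2) * FreeAlgebra.ι ℂ (0 : Fin 2))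
      (ξ • (FreeAlgebra.ι ℂ (0 : Fin 2) * FreeAlgebra.ι ℂ (1 : Fin 2)))

/-- The dual Radford algebra `H_{p,-1}`, the quotient of the free algebra on `a`, `b`
by the two-sided ideal generated by `a^(2p) - 1`, `b²` and `b·a - ξ·a·b`. -/
abbrev DualRadford (p : ℕ) (ξ : ℂ) : Type := RingQuot (HRel p ξ)

/-- The image of the generator `a` in `H_{p,-1}`. -/
def aH (p : ℕ) (ξ : ℂ) : DualRadford p ξ :=
  RingQuot.mkAlgHom ℂ (HRel p ξ) (FreeAlgebra.ι ℂ (0 : Fin 2))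

/-- The image of the generator `b` in `H_{p,-1}`. -/
def bH (p : ℕ) (ξ : ℂ) : DualRadford p ξ :=
  RingQuot.mkAlgHom ℂ (HRel p ξ) (FreeAlgebra.ι ℂ (1 : Fin 2))

namespace DualRadford

variable {p : ℕ} {ξ : ℂ}

lemma aH_pow_two_mul : aH p ξ ^ (2 * p) = 1 := by
  simpa [aH] using RingQuot.mkAlgHom_rel ℂ (HRel.a_pow (p := p) (ξ := ξ))

lemma bH_mul_bH : bH p ξ * bH p ξ = 0 := by
  simpa [bH] using RingQuot.mkAlgHom_rel ℂ (HRel.b_sq (p := p) (ξ := ξ))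

lemma bH_mul_aH : bH p ξ * aH p ξ = ξ • (aH p ξ * bH p ξ) := by
  simpa [aH, bH] using RingQuot.mkAlgHom_rel ℂ (HRel.b_a (p := p) (ξ := ξ))

lemma aH_mul_bH (hξ : ξ ≠ 0) : aH p ξ * bH p ξ = ξ⁻¹ • (bH p ξ * aH p ξ) := by
  rw [bH_mul_aH, smul_smul, inv_mul_cancel₀ hξ, one_smul]

lemma aH_pow_mul_bH (hξ : ξ ≠ 0) (i : ℕ) :
    aH p ξ ^ i * bH p ξ = (ξ ^ i)⁻¹ • (bH p ξ * aH p ξ ^ i) := by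
  induction i with
  | zero => simp
  | succ i ih =>
    rw [pow_succ, mul_assoc, aH_mul_bH hξ, mul_smul_comm, ← mul_assoc, ih, smul_mul_assoc,
      smul_smul, mul_assoc, pow_succ, mul_inv, mul_comm]

lemma aH_pow_mod (i : ℕ) : aH p ξ ^ (i % (2 * p)) = aH p ξ ^ i := by
  conv_rhs => rw [← Nat.mod_add_div i (2 * p), pow_add, pow_mul, aH_pow_two_mul, one_pow, mul_one]

/-- The algebra `H_{p,-1}` is generated by `a` and `b`. -/
lemma adjoin_generators : Algebra.adjoin ℂ {aH p ξ, bH p ξ} = ⊤ := by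
  have h := congrArg (Subalgebra.map (RingQuot.mkAlgHom ℂ (HRel p ξ)))
    (FreeAlgebra.adjoin_range_ι ℂ (Fin 2))
  rw [AlgHom.map_adjoin, Algebra.map_top,
    (AlgHom.range_eq_top _).2 (RingQuot.mkAlgHom_surjective ℂ (HRel p ξ))] at h
  rw [← h]
  congr 1
  ext x
  simp [Fin.exists_fin_two, aH, bH, eq_comm]

/-- The monomials `a^i` and `b·a^i` span `H_{p,-1}`. -/
lemma span_monomials (hξ : ξ ≠ 0) :
    Submodule.span ℂ (Set.range (fun i : ℕ => aH p ξ ^ i) ∪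
      Set.range (fun i : ℕ => bH p ξ * aH p ξ ^ i)) = ⊤ := by
  set S := Submodule.span ℂ (Set.range (fun i : ℕ => aH p ξ ^ i) ∪
    Set.range (fun i : ℕ => bH p ξ * aH p ξ ^ i)) with hS
  have ha (i : ℕ) : aH p ξ ^ i ∈ S := Submodule.subset_span (Or.inl ⟨i, rfl⟩)
  have hb (i : ℕ) : bH p ξ * aH p ξ ^ i ∈ S := Submodule.subset_span (Or.inr ⟨i, rfl⟩)
  have of_monomials (x : DualRadford p ξ) (h₁ : ∀ i : ℕ, x * aH p ξ ^ i ∈ S)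
      (h₂ : ∀ i : ℕ, x * (bH p ξ * aH p ξ ^ i) ∈ S) : S ≤ S.comap (LinearMap.mulLeft ℂ x) := by
    refine Submodule.span_le.2 ?_
    rintro _ (⟨i, rfl⟩ | ⟨i, rfl⟩)
    exacts [h₁ i, h₂ i]
  have mul_mem (x : DualRadford p ξ) : ∀ y ∈ S, x * y ∈ S := by
    have hx : x ∈ Algebra.adjoin ℂ {aH p ξ, bH p ξ} := by simp [adjoin_generators]
    induction hx using Algebra.adjoin_induction with
    | mem x hx =>
      rcases hx with rfl | rfl
      · refine of_monomials _ (fun i => ?_) (fun i => ?_)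
        · rw [← pow_succ']
          exact ha _
        · rw [← mul_assoc, aH_mul_bH hξ, smul_mul_assoc, mul_assoc, ← pow_succ']
          exact S.smul_mem _ (hb _)
      · refine of_monomials _ hb (fun i => ?_)
        rw [← mul_assoc, bH_mul_bH, zero_mul]
        exact S.zero_mem
    | algebraMap r =>
      intro y hy
      rw [← Algebra.smul_def]
      exact S.smul_mem _ hy
    | add x y _ _ hx hy =>
      intro z hz
      rw [add_mul]
      exact S.add_mem (hx z hz) (hy z hz)
    | mul x y _ _ hx hy =>
      intro z hz
      rw [mul_assoc]
      exact hx _ (hy z hz)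
  refine eq_top_iff.2 fun x _ => ?_
  rw [← mul_one x, ← pow_zero (aH p ξ)]
  exact mul_mem x _ (ha 0)

/-- Bilinear maps on `H_{p,-1}` agree as soon as they agree on the monomials. -/
lemma bilin_ext (hξ : ξ ≠ 0) {f g : DualRadford p ξ →ₗ[ℂ] DualRadford p ξ →ₗ[ℂ] ℂ}
    (haa : ∀ i j : ℕ, f (aH p ξ ^ i) (aH p ξ ^ j) = g (aH p ξ ^ i) (aH p ξ ^ j))
    (hab : ∀ i j : ℕ, f (aH p ξ ^ i) (bH p ξ * aH p ξ ^ j) =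
      g (aH p ξ ^ i) (bH p ξ * aH p ξ ^ j))
    (hba : ∀ i j : ℕ, f (bH p ξ * aH p ξ ^ i) (aH p ξ ^ j) =
      g (bH p ξ * aH p ξ ^ i) (aH p ξ ^ j))
    (hbb : ∀ i j : ℕ, f (bH p ξ * aH p ξ ^ i) (bH p ξ * aH p ξ ^ j) =
      g (bH p ξ * aH p ξ ^ i) (bH p ξ * aH p ξ ^ j)) : f = g := by
  refine LinearMap.ext_on (span_monomials hξ) ?_
  rintro _ (⟨i, rfl⟩ | ⟨i, rfl⟩) <;> refine LinearMap.ext_on (span_monomials hξ) ?_ <;>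
    rintro _ (⟨j, rfl⟩ | ⟨j, rfl⟩)
  exacts [haa i j, hab i j, hba i j, hbb i j]

lemma aH_pow_mul_bH_mul_aH_pow (hξ : ξ ≠ 0) (i j : ℕ) :
    aH p ξ ^ i * (bH p ξ * aH p ξ ^ j) = (ξ ^ i)⁻¹ • (bH p ξ * aH p ξ ^ (i + j)) := by
  rw [← mul_assoc, aH_pow_mul_bH hξ, smul_mul_assoc, mul_assoc, ← pow_add]

lemma bH_mul_aH_pow_mul_aH_pow (i j : ℕ) :
    bH p ξ * aH p ξ ^ i * aH p ξ ^ j = bH p ξ * aH p ξ ^ (i + j) := by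
  rw [mul_assoc, ← pow_add]

lemma bH_mul_aH_pow_mul_bH_mul_aH_pow (hξ : ξ ≠ 0) (i j : ℕ) :
    bH p ξ * aH p ξ ^ i * (bH p ξ * aH p ξ ^ j) = 0 := by
  rw [mul_assoc, aH_pow_mul_bH_mul_aH_pow hξ, mul_smul_comm, ← mul_assoc, bH_mul_bH, zero_mul,
    smul_zero]

end DualRadford

/-- the functionals `ε`, `g̃`, `x̃` on `H_{p,-1}` defined on the basis
`{a^i, b·a^i}` as indicated satisfy: `g̃` is an algebra homomorphism (a group-like of the
dual) and `x̃` is `(ε, g̃)`-skew-primitive in the dual. -/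
theorem statement19 (p : ℕ) (hp : 1 ≤ p) (ξ : ℂ) (hξ : IsPrimitiveRoot ξ (2 * p))
    (εf gt xt : DualRadford p ξ →ₗ[ℂ] ℂ)
    (hεa : ∀ i : Fin (2 * p), εf (aH p ξ ^ (i : ℕ)) = 1)
    (hεb : ∀ i : Fin (2 * p), εf (bH p ξ * aH p ξ ^ (i : ℕ)) = 0)
    (hga : ∀ i : Fin (2 * p), gt (aH p ξ ^ (i : ℕ)) = (ξ ^ (i : ℕ))⁻¹)
    (hgb : ∀ i : Fin (2 * p), gt (bH p ξ * aH p ξ ^ (i : ℕ)) = 0)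
    (hxa : ∀ i : Fin (2 * p), xt (aH p ξ ^ (i : ℕ)) = 0)
    (hxb : ∀ i : Fin (2 * p), xt (bH p ξ * aH p ξ ^ (i : ℕ)) = 1) :
    gt 1 = 1 ∧
    (∀ h k : DualRadford p ξ, gt (h * k) = gt h * gt k) ∧
    (∀ h k : DualRadford p ξ, xt (h * k) = xt h * εf k + gt h * xt k) := by
  have hξ0 : ξ ≠ 0 := hξ.ne_zero (by omega)
  have hlt (i : ℕ) : i % (2 * p) < 2 * p := Nat.mod_lt _ (by omega)
  have ea (i : ℕ) : εf (aH p ξ ^ i) = 1 := by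
    simpa [DualRadford.aH_pow_mod] using hεa ⟨_, hlt i⟩
  have eb (i : ℕ) : εf (bH p ξ * aH p ξ ^ i) = 0 := by
    simpa [DualRadford.aH_pow_mod] using hεb ⟨_, hlt i⟩
  have ga (i : ℕ) : gt (aH p ξ ^ i) = (ξ ^ i)⁻¹ := by
    have hpow : ξ ^ (i % (2 * p)) = ξ ^ i := by
      rw [hξ.eq_orderOf, pow_mod_orderOf]
    simpa only [DualRadford.aH_pow_mod, hpow] using hga ⟨_, hlt i⟩
  have gb (i : ℕ) : gt (bH p ξ * aH p ξ ^ i) = 0 := by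
    simpa [DualRadford.aH_pow_mod] using hgb ⟨_, hlt i⟩
  have xa (i : ℕ) : xt (aH p ξ ^ i) = 0 := by
    simpa [DualRadford.aH_pow_mod] using hxa ⟨_, hlt i⟩
  have xb (i : ℕ) : xt (bH p ξ * aH p ξ ^ i) = 1 := by
    simpa [DualRadford.aH_pow_mod] using hxb ⟨_, hlt i⟩
  refine ⟨by simpa using ga 0, fun h k => ?_, fun h k => ?_⟩
  · have key : (LinearMap.mul ℂ (DualRadford p ξ)).compr₂ gt =
        (LinearMap.mul ℂ ℂ).compl₁₂ gt gt := by
      refine DualRadford.bilin_ext hξ0 ?_ ?_ ?_ ?_ <;> intro i j <;>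
        simp [← pow_add, DualRadford.aH_pow_mul_bH_mul_aH_pow hξ0,
          DualRadford.bH_mul_aH_pow_mul_aH_pow,
          DualRadford.bH_mul_aH_pow_mul_bH_mul_aH_pow hξ0, ga, gb]
      rw [pow_add, mul_inv]
    exact LinearMap.congr_fun₂ key h k
  · have key : (LinearMap.mul ℂ (DualRadford p ξ)).compr₂ xt =
        (LinearMap.mul ℂ ℂ).compl₁₂ xt εf + (LinearMap.mul ℂ ℂ).compl₁₂ gt xt := by
      refine DualRadford.bilin_ext hξ0 ?_ ?_ ?_ ?_ <;> intro i j <;>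
        simp [← pow_add, DualRadford.aH_pow_mul_bH_mul_aH_pow hξ0,
          DualRadford.bH_mul_aH_pow_mul_aH_pow,
          DualRadford.bH_mul_aH_pow_mul_bH_mul_aH_pow hξ0, ea, eb, ga, gb, xa, xb]
    exact LinearMap.congr_fun₂ key h k
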